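/- arXiv:2301.00753 — 2 statements merged into one kernel-verified Lean document; each statement's English description precedes it below -/
import Mathlib

section
/- Let f be a monic irreducible divisor of x^n−1 over F_p with deg(f)=k, and let N be the ideal of R = F_{p^2}[x]/⟨x^n−1⟩ generated by (x^n−1)/f. Then N contains exactly p^k + 1 irreducible additive cyclic codes (minimal nonzero F_p[x]-submodules), and they are precisely the pairwise distinct codes ⟨((x^n−1)/f)·(ω+g(x))⟩_{F_p[x]} for g(x) ∈ F_p[x] with deg(g) < k, together with ⟨(x^n−1)/f⟩_{F_p[x]}. (The paper states the count as 2^k+1, which is the value p^k+1 in the binary case p=2.) -/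
open Polynomial

/-- `R = F_{p^2}[x]/⟨x^n - 1⟩`. -/
abbrev Rq (p n : ℕ) [Fact p.Prime] : Type :=
  AdjoinRoot ((X : Polynomial (GaloisField p 2)) ^ n - 1)

/-- The natural ring homomorphism `F_p[x] → F_{p^2}[x]/⟨x^n - 1⟩`. -/
noncomputable def phi (p n : ℕ) [Fact p.Prime] : Polynomial (ZMod p) →+* Rq p n :=
  (AdjoinRoot.mk _).comp (mapRingHom (algebraMap (ZMod p) (GaloisField p 2)))

/-- An additive cyclic code: an `F_p`-subspace of `R` closed under multiplication by `x`,
i.e. an `F_p[x]`-submodule of `R`. -/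
def IsAdditiveCyclic (p n : ℕ) [Fact p.Prime] (C : Submodule (ZMod p) (Rq p n)) : Prop :=
  ∀ c ∈ C, phi p n X * c ∈ C

/-- An irreducible additive cyclic code: a nonzero additive cyclic code whose only additive
cyclic subcodes are `0` and itself. -/
def IsIrreducibleACC (p n : ℕ) [Fact p.Prime] (C : Submodule (ZMod p) (Rq p n)) : Prop :=
  IsAdditiveCyclic p n C ∧ C ≠ ⊥ ∧
    ∀ D : Submodule (ZMod p) (Rq p n), IsAdditiveCyclic p n D → D ≤ C → D = ⊥ ∨ D = C

/-- The `F_p[x]`-submodule of `R` generated by `r`, as a set. -/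
def genSet (p n : ℕ) [Fact p.Prime] (r : Rq p n) : Set (Rq p n) :=
  {w : Rq p n | ∃ a : Polynomial (ZMod p), w = phi p n a * r}

section GaloisField

variable {p : ℕ} [Fact p.Prime] {ω : GaloisField p 2}

theorem eq_zero_of_add_mul_eq_zero
    (hω : ∃ q : Polynomial (ZMod p), Irreducible q ∧ q.natDegree = 2 ∧
      Polynomial.aeval ω q = 0) {a b : ZMod p}
    (h : algebraMap (ZMod p) (GaloisField p 2) a +
      ω * algebraMap (ZMod p) (GaloisField p 2) b = 0) : a = 0 ∧ b = 0 := by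
  obtain ⟨q, hq, hdeg, hroot⟩ := hω
  have hb : b = 0 := by
    by_contra hb
    have hb' : algebraMap (ZMod p) (GaloisField p 2) b ≠ 0 := by
      simpa using hb
    have hωeq : ω = algebraMap (ZMod p) (GaloisField p 2) (-a / b) := by
      rw [map_div₀, map_neg, eq_div_iff hb']
      linear_combination h
    rw [hωeq, aeval_algebraMap_apply, map_eq_zero, coe_aeval_eq_eval] at hroot
    have hdeg' : q.natDegree = 1 :=
      natDegree_eq_of_degree_eq_some (degree_eq_one_of_irreducible_of_root hq hroot)
    omega
  subst hb
  simpa using h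

theorem exists_eq_add_mul
    (hω : ∃ q : Polynomial (ZMod p), Irreducible q ∧ q.natDegree = 2 ∧
      Polynomial.aeval ω q = 0) (x : GaloisField p 2) :
    ∃ a b : ZMod p, x = algebraMap (ZMod p) (GaloisField p 2) a +
      ω * algebraMap (ZMod p) (GaloisField p 2) b := by
  have hli : LinearIndependent (ZMod p) ![1, ω] := by
    rw [LinearIndependent.pair_iff]
    intro s t h
    apply eq_zero_of_add_mul_eq_zero hω
    rw [Algebra.smul_def, Algebra.smul_def] at h
    linear_combination h
  have hspan := hli.span_eq_top_of_card_eq_finrank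
    (by rw [GaloisField.finrank p two_ne_zero, Fintype.card_fin])
  have hx : x ∈ Submodule.span (ZMod p) (Set.range ![1, ω]) := hspan ▸ Submodule.mem_top
  rw [Matrix.range_cons, Matrix.range_cons, Matrix.range_empty, Set.union_empty,
    Set.singleton_union, Submodule.mem_span_pair] at hx
  obtain ⟨a, b, rfl⟩ := hx
  refine ⟨a, b, ?_⟩
  rw [Algebra.smul_def, Algebra.smul_def]
  ring

theorem exists_polynomial_eq_add_mul
    (hω : ∃ q : Polynomial (ZMod p), Irreducible q ∧ q.natDegree = 2 ∧
      Polynomial.aeval ω q = 0) (P : Polynomial (GaloisField p 2)) :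
    ∃ a b : Polynomial (ZMod p), P = a.map (algebraMap (ZMod p) (GaloisField p 2)) +
      C ω * b.map (algebraMap (ZMod p) (GaloisField p 2)) := by
  induction P using Polynomial.induction_on' with
  | add P Q hP hQ =>
    obtain ⟨a, b, rfl⟩ := hP
    obtain ⟨c, d, rfl⟩ := hQ
    refine ⟨a + c, b + d, ?_⟩
    rw [Polynomial.map_add, Polynomial.map_add]
    ring
  | monomial m x =>
    obtain ⟨a, b, rfl⟩ := exists_eq_add_mul hω x
    refine ⟨monomial m a, monomial m b, ?_⟩
    rw [map_monomial, map_monomial, C_mul_monomial, ← map_add]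

theorem polynomial_eq_zero_of_add_mul_eq_zero
    (hω : ∃ q : Polynomial (ZMod p), Irreducible q ∧ q.natDegree = 2 ∧
      Polynomial.aeval ω q = 0) {a b : Polynomial (ZMod p)}
    (h : a.map (algebraMap (ZMod p) (GaloisField p 2)) +
      C ω * b.map (algebraMap (ZMod p) (GaloisField p 2)) = 0) : a = 0 ∧ b = 0 := by
  have key (m : ℕ) : a.coeff m = 0 ∧ b.coeff m = 0 := by
    apply eq_zero_of_add_mul_eq_zero hω
    simpa using congrArg (fun P => P.coeff m) h
  exact ⟨Polynomial.ext fun m => (key m).1, Polynomial.ext fun m => (key m).2⟩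

theorem dvd_of_map_dvd_add_mul
    (hω : ∃ q : Polynomial (ZMod p), Irreducible q ∧ q.natDegree = 2 ∧
      Polynomial.aeval ω q = 0) {f a b : Polynomial (ZMod p)}
    (h : f.map (algebraMap (ZMod p) (GaloisField p 2)) ∣
      a.map (algebraMap (ZMod p) (GaloisField p 2)) +
        C ω * b.map (algebraMap (ZMod p) (GaloisField p 2))) : f ∣ a ∧ f ∣ b := by
  obtain ⟨Q, hQ⟩ := h
  obtain ⟨c, d, rfl⟩ := exists_polynomial_eq_add_mul hω Q
  obtain ⟨h₁, h₂⟩ := polynomial_eq_zero_of_add_mul_eq_zero hω (a := a - f * c) (b := b - f * d)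
    (by
      rw [Polynomial.map_sub, Polynomial.map_sub, Polynomial.map_mul, Polynomial.map_mul]
      linear_combination hQ)
  exact ⟨⟨c, sub_eq_zero.mp h₁⟩, ⟨d, sub_eq_zero.mp h₂⟩⟩

end GaloisField

section Codes

variable {p n : ℕ} [Fact p.Prime]

theorem exists_eq_phi_add_mul {ω : GaloisField p 2}
    (hω : ∃ q : Polynomial (ZMod p), Irreducible q ∧ q.natDegree = 2 ∧
      Polynomial.aeval ω q = 0) (r : Rq p n) :
    ∃ a b : Polynomial (ZMod p),
      r = phi p n a + algebraMap (GaloisField p 2) (Rq p n) ω * phi p n b := by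
  obtain ⟨P, rfl⟩ := AdjoinRoot.mk_surjective r
  obtain ⟨a, b, rfl⟩ := exists_polynomial_eq_add_mul hω P
  exact ⟨a, b, by rw [map_add, map_mul]; rfl⟩

theorem dvd_of_phi_mul_add_mul_eq_zero {ω : GaloisField p 2}
    (hω : ∃ q : Polynomial (ZMod p), Irreducible q ∧ q.natDegree = 2 ∧
      Polynomial.aeval ω q = 0) (hn : 0 < n) {f h a b : Polynomial (ZMod p)}
    (hfh : X ^ n - 1 = f * h)
    (hzero : phi p n h *
      (phi p n a + algebraMap (GaloisField p 2) (Rq p n) ω * phi p n b) = 0) :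
    f ∣ a ∧ f ∣ b := by
  have hmk : AdjoinRoot.mk ((X : Polynomial (GaloisField p 2)) ^ n - 1)
      (h.map (algebraMap (ZMod p) (GaloisField p 2)) *
        (a.map (algebraMap (ZMod p) (GaloisField p 2)) +
          C ω * b.map (algebraMap (ZMod p) (GaloisField p 2)))) = 0 := by
    rw [map_mul, map_add, map_mul]
    exact hzero
  have hmap : (X : Polynomial (GaloisField p 2)) ^ n - 1 =
      h.map (algebraMap (ZMod p) (GaloisField p 2)) *
        f.map (algebraMap (ZMod p) (GaloisField p 2)) := by
    rw [mul_comm, ← Polynomial.map_mul, ← hfh]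
    simp
  rw [AdjoinRoot.mk_eq_zero, hmap] at hmk
  refine dvd_of_map_dvd_add_mul hω ((mul_dvd_mul_iff_left ?_).mp hmk)
  intro h0
  rw [h0, zero_mul] at hmap
  exact (monic_X_pow_sub_C (1 : GaloisField p 2) hn.ne').ne_zero (by simpa using hmap)

theorem phi_X_pow_sub_one : phi p n (X ^ n - 1) = 0 := by
  have : phi p n (X ^ n - 1) =
      AdjoinRoot.mk ((X : Polynomial (GaloisField p 2)) ^ n - 1) (X ^ n - 1) := by
    simp [phi]
  rw [this, AdjoinRoot.mk_self]

theorem smul_eq_phi_C_mul (c : ZMod p) (r : Rq p n) : c • r = phi p n (C c) * r := by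
  rw [Algebra.smul_def]
  congr 1
  exact DFunLike.congr_fun
    (Subsingleton.elim (algebraMap (ZMod p) (Rq p n)) ((phi p n).comp C)) c

theorem IsAdditiveCyclic.phi_mul_mem {D : Submodule (ZMod p) (Rq p n)}
    (hD : IsAdditiveCyclic p n D) (a : Polynomial (ZMod p)) {r : Rq p n} (hr : r ∈ D) :
    phi p n a * r ∈ D := by
  induction a using Polynomial.induction_on with
  | C c =>
    rw [← smul_eq_phi_C_mul]
    exact D.smul_mem c hr
  | add a b ha hb =>
    rw [map_add, add_mul]
    exact D.add_mem ha hb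
  | monomial m c hm =>
    have : phi p n (C c * X ^ (m + 1)) * r = phi p n X * (phi p n (C c * X ^ m) * r) := by
      rw [← mul_assoc, ← map_mul]
      congr 2
      ring
    rw [this]
    exact hD _ hm

/-- The additive cyclic code generated by one element. -/
noncomputable def cyclicCode (r : Rq p n) : Submodule (ZMod p) (Rq p n) where
  carrier := genSet p n r
  add_mem' := by
    rintro _ _ ⟨a, rfl⟩ ⟨b, rfl⟩
    exact ⟨a + b, by rw [map_add, add_mul]⟩
  zero_mem' := ⟨0, by rw [map_zero, zero_mul]⟩
  smul_mem' := by
    rintro c _ ⟨a, rfl⟩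
    exact ⟨C c * a, by rw [smul_eq_phi_C_mul, map_mul, mul_assoc]⟩

theorem coe_cyclicCode (r : Rq p n) : (cyclicCode r : Set (Rq p n)) = genSet p n r := rfl

theorem mem_cyclicCode_self (r : Rq p n) : r ∈ cyclicCode r :=
  ⟨1, by rw [map_one, one_mul]⟩

theorem isAdditiveCyclic_cyclicCode (r : Rq p n) : IsAdditiveCyclic p n (cyclicCode r) := by
  rintro _ ⟨a, rfl⟩
  exact ⟨X * a, by rw [map_mul, mul_assoc]⟩

theorem IsAdditiveCyclic.cyclicCode_le {D : Submodule (ZMod p) (Rq p n)}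
    (hD : IsAdditiveCyclic p n D) {r : Rq p n} (hr : r ∈ D) : cyclicCode r ≤ D := by
  rintro _ ⟨a, rfl⟩
  exact hD.phi_mul_mem a hr

theorem cyclicCode_phi_mul {f a : Polynomial (ZMod p)} (hirr : Irreducible f) (ha : ¬ f ∣ a)
    {r : Rq p n} (hr : phi p n f * r = 0) : cyclicCode (phi p n a * r) = cyclicCode r := by
  apply le_antisymm
  · exact (isAdditiveCyclic_cyclicCode r).cyclicCode_le ⟨a, rfl⟩
  · apply (isAdditiveCyclic_cyclicCode _).cyclicCode_le
    obtain ⟨u, v, huv⟩ := (hirr.coprime_iff_not_dvd).mpr ha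
    refine ⟨v, ?_⟩
    have h1 := congrArg (phi p n) huv
    rw [map_add, map_mul, map_mul, map_one] at h1
    linear_combination (-r) * h1 + phi p n u * hr

theorem isIrreducibleACC_cyclicCode {f : Polynomial (ZMod p)} (hirr : Irreducible f)
    {r : Rq p n} (hr : phi p n f * r = 0) (hr0 : r ≠ 0) :
    IsIrreducibleACC p n (cyclicCode r) := by
  refine ⟨isAdditiveCyclic_cyclicCode r, ?_, fun D hD hle => ?_⟩
  · intro h
    have := mem_cyclicCode_self r
    rw [h, Submodule.mem_bot] at this
    exact hr0 this
  · rw [or_iff_not_imp_left]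
    intro hD0
    obtain ⟨s, hs, hs0⟩ := D.ne_bot_iff.mp hD0
    refine le_antisymm hle ?_
    obtain ⟨a, rfl⟩ := hle hs
    rw [← cyclicCode_phi_mul hirr (a := a) _ hr]
    · exact hD.cyclicCode_le hs
    · rintro ⟨c, rfl⟩
      apply hs0
      rw [map_mul]
      linear_combination phi p n c * hr

theorem IsIrreducibleACC.eq_cyclicCode {D : Submodule (ZMod p) (Rq p n)}
    (hD : IsIrreducibleACC p n D) {r : Rq p n} (hr : r ∈ D) (hr0 : r ≠ 0) :
    D = cyclicCode r := by
  rcases hD.2.2 _ (isAdditiveCyclic_cyclicCode r) (hD.1.cyclicCode_le hr) with h | h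
  · have := mem_cyclicCode_self r
    rw [h, Submodule.mem_bot] at this
    exact absurd this hr0
  · exact h.symm

theorem ncard_degree_lt (k : ℕ) : {g : Polynomial (ZMod p) | g.degree < (k : ℕ)}.ncard = p ^ k := by
  have hset : {g : Polynomial (ZMod p) | g.degree < (k : ℕ)} = (degreeLT (ZMod p) k : Set _) := by
    ext g
    exact mem_degreeLT.symm
  rw [hset, ← Nat.card_coe_set_eq]
  refine (Nat.card_congr (degreeLTEquiv (ZMod p) k).toEquiv).trans ?_
  simp [Nat.card_eq_fintype_card, ZMod.card]

end Codes

/-- the ideal `N = ⟨(x^n−1)/f⟩` of `R = F_{p^2}[x]/⟨x^n−1⟩` contains exactly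
`p^k + 1` irreducible additive cyclic codes, and they are precisely the pairwise distinct
codes `⟨((x^n−1)/f)(ω+g(x))⟩_{F_p[x]}` for `deg g < k` together with `⟨(x^n−1)/f⟩_{F_p[x]}`. -/
theorem irreducible_codes_in_component
    (p n : ℕ) [Fact p.Prime] (hn : 0 < n) (hco : Nat.Coprime n p)
    (ω : GaloisField p 2)
    (hω : ∃ q : Polynomial (ZMod p), Irreducible q ∧ q.natDegree = 2 ∧
      Polynomial.aeval ω q = 0)
    (f : Polynomial (ZMod p)) (hmon : f.Monic) (hirr : Irreducible f)
    (hdvd : f ∣ X ^ n - 1) (k : ℕ) (hk : f.natDegree = k) :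
    Set.ncard {C : Submodule (ZMod p) (Rq p n) | IsIrreducibleACC p n C ∧
        (C : Set (Rq p n)) ⊆ (Ideal.span {phi p n ((X ^ n - 1) / f)} : Ideal (Rq p n))} =
      p ^ k + 1 ∧
    (∀ C : Submodule (ZMod p) (Rq p n),
      (IsIrreducibleACC p n C ∧
          (C : Set (Rq p n)) ⊆ (Ideal.span {phi p n ((X ^ n - 1) / f)} : Ideal (Rq p n))) ↔
        ((C : Set (Rq p n)) = genSet p n (phi p n ((X ^ n - 1) / f)) ∨
          ∃ g : Polynomial (ZMod p), g.degree < (k : ℕ) ∧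
            (C : Set (Rq p n)) = genSet p n (phi p n ((X ^ n - 1) / f) *
              (algebraMap (GaloisField p 2) (Rq p n) ω + phi p n g)))) ∧
    (∀ g₁ g₂ : Polynomial (ZMod p), g₁.degree < (k : ℕ) → g₂.degree < (k : ℕ) →
      genSet p n (phi p n ((X ^ n - 1) / f) *
          (algebraMap (GaloisField p 2) (Rq p n) ω + phi p n g₁)) =
        genSet p n (phi p n ((X ^ n - 1) / f) *
          (algebraMap (GaloisField p 2) (Rq p n) ω + phi p n g₂)) →
      g₁ = g₂) ∧
    (∀ g : Polynomial (ZMod p), g.degree < (k : ℕ) →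
      genSet p n (phi p n ((X ^ n - 1) / f) *
          (algebraMap (GaloisField p 2) (Rq p n) ω + phi p n g)) ≠
        genSet p n (phi p n ((X ^ n - 1) / f))) := by
  obtain ⟨h, hfh⟩ := hdvd
  have hdiv : (X ^ n - 1 : Polynomial (ZMod p)) / f = h := by
    rw [hfh, mul_div_cancel_left₀ _ hirr.ne_zero]
  rw [hdiv]
  set w := algebraMap (GaloisField p 2) (Rq p n) ω with hw
  set u := phi p n h with hu
  have hfu : phi p n f * u = 0 := by
    rw [hu, ← map_mul, ← hfh, phi_X_pow_sub_one]
  have hzero {a b : Polynomial (ZMod p)} (h0 : u * (phi p n a + w * phi p n b) = 0) :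
      f ∣ a ∧ f ∣ b := dvd_of_phi_mul_add_mul_eq_zero hω hn hfh h0
  have hu0 : u ≠ 0 := by
    intro h0
    refine hirr.not_dvd_one (hzero (a := 1) (b := 0) ?_).1
    rw [h0, zero_mul]
  have hg0 (g : Polynomial (ZMod p)) : u * (w + phi p n g) ≠ 0 := by
    intro h0
    refine hirr.not_dvd_one (hzero (a := g) (b := 1) ?_).2
    rw [map_one]
    linear_combination h0
  have hfg (r : Rq p n) : phi p n f * (u * r) = 0 := by
    linear_combination r * hfu
  have hinj (g₁ g₂ : Polynomial (ZMod p)) (hg₁ : g₁.degree < (k : ℕ))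
      (hg₂ : g₂.degree < (k : ℕ))
      (heq : genSet p n (u * (w + phi p n g₁)) = genSet p n (u * (w + phi p n g₂))) :
      g₁ = g₂ := by
    have hmem : u * (w + phi p n g₁) ∈ genSet p n (u * (w + phi p n g₂)) :=
      heq ▸ mem_cyclicCode_self (u * (w + phi p n g₁))
    obtain ⟨a, ha⟩ := hmem
    obtain ⟨h₁, h₂⟩ := hzero (a := g₁ - a * g₂) (b := 1 - a) (by
      rw [map_sub, map_sub, map_mul, map_one]
      linear_combination ha)
    have hsub : f ∣ g₁ - g₂ := by
      have := dvd_sub h₁ (h₂.mul_right g₂)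
      ring_nf at this
      exact this
    refine sub_eq_zero.mp (eq_zero_of_dvd_of_degree_lt hsub ?_)
    rw [degree_eq_natDegree hirr.ne_zero, hk]
    exact (degree_sub_le _ _).trans_lt (max_lt hg₁ hg₂)
  have hne (g : Polynomial (ZMod p)) : genSet p n (u * (w + phi p n g)) ≠ genSet p n u := by
    intro heq
    have hmem : u * (w + phi p n g) ∈ genSet p n u :=
      heq ▸ mem_cyclicCode_self (u * (w + phi p n g))
    obtain ⟨a, ha⟩ := hmem
    refine hirr.not_dvd_one (hzero (a := g - a) (b := 1) ?_).2
    rw [map_sub, map_one]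
    linear_combination ha
  have hclass (D : Submodule (ZMod p) (Rq p n)) :
      (IsIrreducibleACC p n D ∧ (D : Set (Rq p n)) ⊆ (Ideal.span {u} : Ideal (Rq p n))) ↔
        ((D : Set (Rq p n)) = genSet p n u ∨
          ∃ g : Polynomial (ZMod p), g.degree < (k : ℕ) ∧
            (D : Set (Rq p n)) = genSet p n (u * (w + phi p n g))) := by
    constructor
    · rintro ⟨hD, hDN⟩
      obtain ⟨r, hr, hr0⟩ := D.ne_bot_iff.mp hD.2.1
      have hDr := hD.eq_cyclicCode hr hr0
      obtain ⟨s, rfl⟩ := Ideal.mem_span_singleton.mp (hDN hr)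
      obtain ⟨a, b, rfl⟩ := exists_eq_phi_add_mul hω s
      by_cases hb : f ∣ b
      · left
        obtain ⟨c, rfl⟩ := hb
        have hra : u * (phi p n a + w * phi p n (f * c)) = phi p n a * u := by
          rw [map_mul]
          linear_combination w * phi p n c * hfu
        rw [← hw, hra] at hDr hr0
        rw [hDr, cyclicCode_phi_mul hirr _ hfu, coe_cyclicCode]
        rintro ⟨d, rfl⟩
        apply hr0
        rw [map_mul]
        linear_combination phi p n d * hfu
      · right
        obtain ⟨c, d, hcd⟩ := (hirr.coprime_iff_not_dvd).mpr hb
        refine ⟨(a * d) %ₘ f, ?_, ?_⟩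
        · rw [← hk, ← degree_eq_natDegree hirr.ne_zero]
          exact degree_modByMonic_lt _ hmon
        · have hmod := congrArg (phi p n) (modByMonic_add_div (a * d) f)
          have hcd' := congrArg (phi p n) hcd
          simp only [map_add, map_mul, map_one] at hmod hcd'
          have hra : u * (phi p n a + w * phi p n b) =
              phi p n b * (u * (w + phi p n ((a * d) %ₘ f))) := by
            linear_combination (-u * phi p n a) * hcd' - u * phi p n b * hmod +
              (phi p n a * phi p n c + phi p n b * phi p n ((a * d) /ₘ f)) * hfu
          rw [hDr, ← hw, hra, cyclicCode_phi_mul hirr hb (hfg _), coe_cyclicCode]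
    · rintro (hD | ⟨g, -, hD⟩)
      · obtain rfl : D = cyclicCode u := SetLike.coe_injective hD
        refine ⟨isIrreducibleACC_cyclicCode hirr hfu hu0, ?_⟩
        rintro _ ⟨a, rfl⟩
        exact Ideal.mul_mem_left _ _ (Ideal.mem_span_singleton_self u)
      · obtain rfl : D = cyclicCode (u * (w + phi p n g)) := SetLike.coe_injective hD
        refine ⟨isIrreducibleACC_cyclicCode hirr (hfg _) (hg0 g), ?_⟩
        rintro _ ⟨a, rfl⟩
        exact Ideal.mul_mem_left _ _
          (Ideal.mul_mem_right _ _ (Ideal.mem_span_singleton_self u))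
  refine ⟨?_, hclass, hinj, fun g _ => hne g⟩
  have hset : {D : Submodule (ZMod p) (Rq p n) | IsIrreducibleACC p n D ∧
      (D : Set (Rq p n)) ⊆ (Ideal.span {u} : Ideal (Rq p n))} =
      insert (cyclicCode u) ((fun g => cyclicCode (u * (w + phi p n g))) ''
        {g : Polynomial (ZMod p) | g.degree < (k : ℕ)}) := by
    ext D
    simp only [← coe_cyclicCode, SetLike.coe_set_eq] at hclass
    rw [Set.mem_ofPred_eq, hclass, Set.mem_insert_iff, Set.mem_image]
    refine or_congr_right (exists_congr fun g => and_congr_right fun _ => eq_comm)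
  have hcard := ncard_degree_lt (p := p) k
  have hfin : {g : Polynomial (ZMod p) | g.degree < (k : ℕ)}.Finite :=
    Set.finite_of_ncard_ne_zero (by
      rw [hcard]
      exact pow_ne_zero _ (Fact.out : p.Prime).ne_zero)
  rw [hset, Set.ncard_insert_of_notMem _ (hfin.image _), Set.InjOn.ncard_image, hcard]
  · intro g₁ hg₁ g₂ hg₂ heq
    exact hinj g₁ g₂ hg₁ hg₂ (congrArg SetLike.coe heq)
  · rintro ⟨g, -, hg⟩
    exact hne g (congrArg SetLike.coe hg)
end

section
/- Let C = ⟨g(x)+ω·k(x)⟩_{F_p[x]} be an additive cyclic code of length n over F_{p^2} generated by a single element. Let C_1, C_2, C_3, C_4 be the length-n linear cyclic codes over F_p generated by g(x), k(x), ((x^n−1)/gcd(x^n−1, g(x)))·k(x), and ((x^n−1)/gcd(x^n−1, k(x)))·g(x), respectively. Then min{ d(C_3), d(C_4), max{d(C_1), d(C_2)} } ≤ d(C), where any zero code C_i is discarded from the minimum (equivalently d({0}) = ∞). -/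
open Polynomial

theorem monicXn {F : Type*} [Field F] (n : ℕ) (hn : n ≠ 0) :
    ((X : Polynomial F) ^ n - 1).Monic := by
  simpa using Polynomial.monic_X_pow_sub_C (1 : F) hn

/-- The Hamming weight of an element of `F[x]/⟨x^n - 1⟩`: the number of nonzero
coefficients of its canonical representative of degree `< n`. -/
noncomputable def wt {F : Type*} [Field F] (n : ℕ) (hn : n ≠ 0)
    (y : AdjoinRoot ((X : Polynomial F) ^ n - 1)) : ℕ :=
  ((AdjoinRoot.modByMonicHom (monicXn n hn) y).support).card

/-- The minimum distance `d(C)` of a code `C ⊆ F[x]/⟨x^n - 1⟩` (with `d({0}) = ∞`). -/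
noncomputable def dmin {F : Type*} [Field F] (n : ℕ) (hn : n ≠ 0)
    (C : Set (AdjoinRoot ((X : Polynomial F) ^ n - 1))) : ℕ∞ :=
  sInf ((fun y => (wt n hn y : ℕ∞)) '' (C \ {0}))

theorem wt_mk {F : Type*} [Field F] (n : ℕ) (hn : n ≠ 0) (f : Polynomial F) :
    wt n hn (AdjoinRoot.mk _ f) = (f %ₘ (X ^ n - 1)).support.card := by
  rw [wt, AdjoinRoot.modByMonicHom_mk]

theorem dmin_le_wt {F : Type*} [Field F] {n : ℕ} {hn : n ≠ 0}
    {C : Set (AdjoinRoot ((X : Polynomial F) ^ n - 1))}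
    {y : AdjoinRoot ((X : Polynomial F) ^ n - 1)} (hy : y ∈ C) (h0 : y ≠ 0) :
    dmin n hn C ≤ wt n hn y :=
  sInf_le ⟨y, ⟨hy, h0⟩, rfl⟩

theorem dmin_span_mk_le {F : Type*} [Field F] {n : ℕ} {hn : n ≠ 0} {g f : Polynomial F}
    (hgf : g ∣ f) (h0 : AdjoinRoot.mk ((X : Polynomial F) ^ n - 1) f ≠ 0) :
    dmin (F := F) n hn (Ideal.span {AdjoinRoot.mk ((X : Polynomial F) ^ n - 1) g} :
      Ideal (AdjoinRoot ((X : Polynomial F) ^ n - 1))) ≤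
      ((f %ₘ (X ^ n - 1)).support.card : ℕ∞) := by
  rw [← wt_mk n hn]
  exact dmin_le_wt (Ideal.mem_span_singleton.mpr (map_dvd _ hgf)) h0

theorem EuclideanDomain.div_gcd_dvd_of_dvd_mul {R : Type*} [EuclideanDomain R] [DecidableEq R]
    {m g a : R} (hm : m ≠ 0) (h : m ∣ a * g) : m / EuclideanDomain.gcd m g ∣ a := by
  have hd0 : EuclideanDomain.gcd m g ≠ 0 := fun h0 =>
    hm (EuclideanDomain.gcd_eq_zero_iff.mp h0).1
  have hmul := EuclideanDomain.mul_div_cancel' hd0 (EuclideanDomain.gcd_dvd_left m g)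
  refine (mul_dvd_mul_iff_left hd0).mp ?_
  rw [hmul]
  conv_rhs => rw [EuclideanDomain.gcd_eq_gcd_ab m g]
  obtain ⟨c, hc⟩ := h
  exact ⟨EuclideanDomain.gcdA m g * a + c * EuclideanDomain.gcdB m g, by
    linear_combination EuclideanDomain.gcdB m g * hc⟩

theorem algebraMap_add_mul_eq_zero_iff {F K : Type*} [Field F] [Field K] [Algebra F K] {ω : K}
    (hω : ∀ c : F, algebraMap F K c ≠ ω) {a b : F} :
    algebraMap F K a + ω * algebraMap F K b = 0 ↔ a = 0 ∧ b = 0 := by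
  refine ⟨fun h => ?_, by rintro ⟨rfl, rfl⟩; simp⟩
  have hb : b = 0 := by
    by_contra hb
    have hb' : algebraMap F K b ≠ 0 := by simpa using hb
    apply hω (-a / b)
    rw [map_div₀, map_neg, div_eq_iff hb']
    linear_combination -h
  subst hb
  simpa using h

theorem algebraMap_ne_of_aeval_eq_zero {F K : Type*} [Field F] [Field K] [Algebra F K] {ω : K}
    {q : Polynomial F} (hq : Irreducible q) (hdeg : q.natDegree ≠ 1) (h : aeval ω q = 0)
    (c : F) : algebraMap F K c ≠ ω := by
  rintro rfl
  rw [aeval_algebraMap_apply, map_eq_zero] at h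
  exact hdeg (natDegree_eq_of_degree_eq_some (degree_eq_one_of_irreducible_of_root hq h))

theorem modByMonic_map_add_C_mul {F K : Type*} [Field F] [Field K] [Algebra F K] (ω : K)
    {m : Polynomial F} (hm : m.Monic) (u v : Polynomial F) :
    (u.map (algebraMap F K) + C ω * v.map (algebraMap F K)) %ₘ m.map (algebraMap F K) =
      (u %ₘ m).map (algebraMap F K) + C ω * (v %ₘ m).map (algebraMap F K) := by
  rw [add_modByMonic, ← smul_eq_C_mul, smul_modByMonic, ← map_modByMonic _ hm,
    ← map_modByMonic _ hm, smul_eq_C_mul]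

theorem support_map_add_C_mul {F K : Type*} [Field F] [Field K] [Algebra F K] {ω : K}
    (hω : ∀ c : F, algebraMap F K c ≠ ω) (u v : Polynomial F) :
    (u.map (algebraMap F K) + C ω * v.map (algebraMap F K)).support =
      u.support ∪ v.support := by
  ext i
  simp only [mem_support_iff, coeff_add, coeff_C_mul, coeff_map, Finset.mem_union, ne_eq,
    algebraMap_add_mul_eq_zero_iff hω, not_and_or]

/-- minimum-distance lower bound for the one-generator additive cyclic code
`C = ⟨g(x)+ω·k(x)⟩_{F_p[x]}` in terms of the linear cyclic codes over `F_p` generated by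
`g`, `k`, `((x^n−1)/gcd(x^n−1,g))·k` and `((x^n−1)/gcd(x^n−1,k))·g`. -/
theorem distance_bound_one_generator
    (p n : ℕ) [Fact p.Prime] (hn : n ≠ 0) (hco : Nat.Coprime n p)
    (ω : GaloisField p 2)
    (hω : ∃ q : Polynomial (ZMod p), Irreducible q ∧ q.natDegree = 2 ∧
      Polynomial.aeval ω q = 0)
    (g k : Polynomial (ZMod p)) :
    min
      (min
        (dmin (F := ZMod p) n hn (Ideal.span {AdjoinRoot.mk ((X : Polynomial (ZMod p)) ^ n - 1)
          (((X ^ n - 1) / EuclideanDomain.gcd (X ^ n - 1) g) * k)} :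
            Ideal (AdjoinRoot ((X : Polynomial (ZMod p)) ^ n - 1))))
        (dmin (F := ZMod p) n hn (Ideal.span {AdjoinRoot.mk ((X : Polynomial (ZMod p)) ^ n - 1)
          (((X ^ n - 1) / EuclideanDomain.gcd (X ^ n - 1) k) * g)} :
            Ideal (AdjoinRoot ((X : Polynomial (ZMod p)) ^ n - 1)))))
      (max
        (dmin (F := ZMod p) n hn (Ideal.span {AdjoinRoot.mk ((X : Polynomial (ZMod p)) ^ n - 1) g} :
          Ideal (AdjoinRoot ((X : Polynomial (ZMod p)) ^ n - 1))))
        (dmin (F := ZMod p) n hn (Ideal.span {AdjoinRoot.mk ((X : Polynomial (ZMod p)) ^ n - 1) k} :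
          Ideal (AdjoinRoot ((X : Polynomial (ZMod p)) ^ n - 1))))) ≤
    dmin (F := GaloisField p 2) n hn {w : Rq p n | ∃ a : Polynomial (ZMod p),
      w = phi p n a * (phi p n g + algebraMap (GaloisField p 2) (Rq p n) ω * phi p n k)} := by
  obtain ⟨q, hq, hq2, hqω⟩ := hω
  have hω := algebraMap_ne_of_aeval_eq_zero hq (by omega) hqω
  have hM := monicXn (F := ZMod p) n hn
  refine le_sInf ?_
  rintro _ ⟨_, ⟨⟨a, rfl⟩, hy⟩, rfl⟩
  have hw : phi p n a * (phi p n g + algebraMap (GaloisField p 2) (Rq p n) ω * phi p n k) =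
      AdjoinRoot.mk _ ((a * g).map (algebraMap (ZMod p) (GaloisField p 2)) +
        C ω * (a * k).map (algebraMap (ZMod p) (GaloisField p 2))) := by
    simp only [phi, RingHom.comp_apply, coe_mapRingHom, Polynomial.map_mul, map_add, map_mul,
      AdjoinRoot.algebraMap_eq, AdjoinRoot.mk_C]
    ring
  have hmap : ((X : Polynomial (ZMod p)) ^ n - 1).map (algebraMap (ZMod p) (GaloisField p 2)) =
      X ^ n - 1 := by simp
  have hwt : wt n hn
      (phi p n a * (phi p n g + algebraMap (GaloisField p 2) (Rq p n) ω * phi p n k)) =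
      (((a * g) %ₘ (X ^ n - 1)).support ∪ ((a * k) %ₘ (X ^ n - 1)).support).card := by
    rw [hw, wt_mk, ← hmap, modByMonic_map_add_C_mul ω hM, support_map_add_C_mul hω]
  have hleft : (((a * g) %ₘ (X ^ n - 1)).support.card : ℕ∞) ≤ wt n hn
      (phi p n a * (phi p n g + algebraMap (GaloisField p 2) (Rq p n) ω * phi p n k)) := by
    rw [hwt]
    exact_mod_cast Finset.card_le_card Finset.subset_union_left
  have hright : (((a * k) %ₘ (X ^ n - 1)).support.card : ℕ∞) ≤ wt n hn
      (phi p n a * (phi p n g + algebraMap (GaloisField p 2) (Rq p n) ω * phi p n k)) := by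
    rw [hwt]
    exact_mod_cast Finset.card_le_card Finset.subset_union_right
  have hne : ¬ (AdjoinRoot.mk ((X : Polynomial (ZMod p)) ^ n - 1) (a * g) = 0 ∧
      AdjoinRoot.mk ((X : Polynomial (ZMod p)) ^ n - 1) (a * k) = 0) := by
    rintro ⟨hu, hv⟩
    refine hy ?_
    rw [Set.mem_singleton_iff, hw, AdjoinRoot.mk_eq_zero, ← hmap]
    exact dvd_add (Polynomial.map_dvd (algebraMap (ZMod p) (GaloisField p 2)) (AdjoinRoot.mk_eq_zero.mp hu))
      ((Polynomial.map_dvd (algebraMap (ZMod p) (GaloisField p 2)) (AdjoinRoot.mk_eq_zero.mp hv)).mul_left _)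
  by_cases hu : AdjoinRoot.mk ((X : Polynomial (ZMod p)) ^ n - 1) (a * g) = 0
  · have hdvd := EuclideanDomain.div_gcd_dvd_of_dvd_mul hM.ne_zero (AdjoinRoot.mk_eq_zero.mp hu)
    exact (min_le_left _ _).trans <| (min_le_left _ _).trans <|
      (dmin_span_mk_le (mul_dvd_mul_right hdvd k) fun hv => hne ⟨hu, hv⟩).trans hright
  by_cases hv : AdjoinRoot.mk ((X : Polynomial (ZMod p)) ^ n - 1) (a * k) = 0
  · have hdvd := EuclideanDomain.div_gcd_dvd_of_dvd_mul hM.ne_zero (AdjoinRoot.mk_eq_zero.mp hv)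
    exact (min_le_left _ _).trans <| (min_le_right _ _).trans <|
      (dmin_span_mk_le (mul_dvd_mul_right hdvd g) hu).trans hleft
  exact (min_le_right _ _).trans <| max_le
    ((dmin_span_mk_le (dvd_mul_left g a) hu).trans hleft)
    ((dmin_span_mk_le (dvd_mul_left k a) hv).trans hright)
end
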